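/- Let G be the cycle graph on n ≥ 3 vertices and let V_ℓ be a set of m leader nodes with 2 ≤ m ≤ n. Let a = min{ d(ℓ, ℓ') : ℓ, ℓ' ∈ V_ℓ, ℓ ≠ ℓ' } be the smallest graph distance between any two distinct leaders. Then there exists a PMI sequence of distance-to-leader vectors of length at least n − a. -/

import Mathlib

/-- A sequence `f` of `δ` pairwise distinct nodes of `G` is a PMI sequence of
distance-to-leader vectors with leader set `L`. -/
def IsPMISeq {V : Type*} (G : SimpleGraph V) (L : Finset V) {δ : ℕ}
    (f : Fin δ → V) : Prop :=
  Function.Injective f ∧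
    ∀ i : Fin δ, ∃ ℓ ∈ L, ∀ i' : Fin δ, i < i' →
      G.dist ℓ (f i) < G.dist ℓ (f i')

theorem cyc_adj {n : ℕ} (hn : 3 ≤ n) (u v : Fin n) :
    (SimpleGraph.cycleGraph n).Adj u v ↔
      (u.val + 1 = v.val ∨ v.val + 1 = u.val ∨ u.val + (n - 1) = v.val ∨
        v.val + (n - 1) = u.val) := by
  rw [SimpleGraph.cycleGraph_adj']
  have hu := u.isLt
  have hv := v.isLt
  rcases lt_trichotomy u v with h | h | h
  · rw [Fin.coe_sub_iff_lt.mpr h, Fin.coe_sub_iff_le.mpr h.le]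
    have h' : u.val < v.val := h
    omega
  · subst h
    rw [Fin.coe_sub_iff_le.mpr le_rfl]
    omega
  · rw [Fin.coe_sub_iff_lt.mpr h, Fin.coe_sub_iff_le.mpr h.le]
    have h' : v.val < u.val := h
    omega

theorem cyc_conn {n : ℕ} (hn : 3 ≤ n) : (SimpleGraph.cycleGraph n).Connected := by
  obtain ⟨m, rfl⟩ : ∃ m, n = m + 1 := ⟨n - 1, by omega⟩
  exact SimpleGraph.cycleGraph_connected

theorem cyc_up {n : ℕ} (hn : 3 ≤ n) (d : ℕ) : ∀ u v : Fin n, u.val + d = v.val →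
    (SimpleGraph.cycleGraph n).dist u v ≤ d := by
  induction d with
  | zero =>
    intro u v h
    have : u = v := Fin.ext (by omega)
    subst this
    simp
  | succ d ih =>
    intro u v h
    have hv := v.isLt
    have h1 := ih u ⟨u.val + d, by omega⟩ rfl
    have h2 : (SimpleGraph.cycleGraph n).dist ⟨u.val + d, by omega⟩ v = 1 := by
      rw [SimpleGraph.dist_eq_one_iff_adj, cyc_adj hn]
      left
      simp only
      omega
    have h3 := (cyc_conn hn).dist_triangle (u := u) (v := ⟨u.val + d, by omega⟩) (w := v)
    omega

theorem cyc_low {n : ℕ} (hn : 3 ≤ n) (u v : Fin n)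
    (w : (SimpleGraph.cycleGraph n).Walk u v) :
    (v.val ≤ u.val + w.length ∧ u.val ≤ v.val + w.length) ∨
      n ≤ u.val + w.length - v.val ∨ n ≤ v.val + w.length - u.val := by
  induction w with
  | nil => simp
  | cons h p ih =>
    rename_i a b c
    rw [cyc_adj hn] at h
    rw [SimpleGraph.Walk.length_cons]
    have := a.isLt
    have := b.isLt
    have := c.isLt
    omega

theorem cyc_dist {n : ℕ} (hn : 3 ≤ n) (u v : Fin n) (h : u.val ≤ v.val) :
    (SimpleGraph.cycleGraph n).dist u v = min (v.val - u.val) (n - (v.val - u.val)) := by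
  have hv := v.isLt
  have h1 := cyc_up hn (v.val - u.val) u v (by omega)
  have c := cyc_conn hn
  have h2 := cyc_up hn u.val ⟨0, by omega⟩ u (by simp)
  rw [SimpleGraph.dist_comm] at h2
  have h3 : (SimpleGraph.cycleGraph n).dist ⟨0, by omega⟩ ⟨n - 1, by omega⟩ = 1 := by
    rw [SimpleGraph.dist_eq_one_iff_adj, cyc_adj hn]
    simp
  have h4 := cyc_up hn (n - 1 - v.val) v ⟨n - 1, by omega⟩ (by simp only; omega)
  rw [SimpleGraph.dist_comm] at h4
  have h5 := c.dist_triangle (u := u) (v := ⟨0, by omega⟩) (w := v)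
  have h6 := c.dist_triangle (u := ⟨0, by omega⟩) (v := ⟨n - 1, by omega⟩) (w := v)
  obtain ⟨w, hw⟩ := c.exists_walk_length_eq_dist u v
  have h7 := cyc_low hn u v w
  omega

theorem cyc_dist' {n : ℕ} (hn : 3 ≤ n) (u v : Fin n) (s : ℕ) (hs : s < n)
    (h : v.val = u.val + s ∨ v.val + n = u.val + s) :
    (SimpleGraph.cycleGraph n).dist u v = min s (n - s) := by
  have := u.isLt
  have := v.isLt
  rcases h with h | h
  · rw [cyc_dist hn u v (by omega)]
    omega
  · rw [SimpleGraph.dist_comm, cyc_dist hn v u (by omega)]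
    omega

/-- offsets of the sequence -/
def cycOff (n k i : ℕ) : ℕ :=
  if i = 0 then 0 else if i % 2 = 1 then n - 1 - i / 2 else k + i / 2

/-- shift -/
def cycShift {n : ℕ} (x : Fin n) (s : ℕ) : Fin n :=
  ⟨(x.val + s) % n, Nat.mod_lt _ (by have := x.isLt; omega)⟩

theorem cycShift_val {n : ℕ} (x : Fin n) (s : ℕ) (hs : s < n) :
    (cycShift x s).val = x.val + s ∨ (cycShift x s).val + n = x.val + s := by
  have := x.isLt
  unfold cycShift
  simp only
  by_cases h : x.val + s < n
  · left
    exact Nat.mod_eq_of_lt h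
  · right
    rw [Nat.mod_eq_sub_mod (by omega), Nat.mod_eq_of_lt (by omega)]
    omega

theorem cyc_core {n : ℕ} (hn : 3 ≤ n) (L : Finset (Fin n)) (x y : Fin n) (hx : x ∈ L)
    (hy : y ∈ L) (k : ℕ) (hk : 1 ≤ k) (hkn : k < n)
    (h : y.val = x.val + k ∨ y.val + n = x.val + k) :
    ∃ f : Fin (n - k) → Fin n, IsPMISeq (SimpleGraph.cycleGraph n) L f := by
  have hoff : ∀ i : Fin (n - k), cycOff n k i.val < n := by
    intro i
    have := i.isLt
    unfold cycOff
    split_ifs <;> omega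
  refine ⟨fun i => cycShift x (cycOff n k i.val), ?_, ?_⟩
  · intro i j hij
    have hi := cycShift_val x _ (hoff i)
    have hj := cycShift_val x _ (hoff j)
    have hi' := hoff i
    have hj' := hoff j
    simp only at hij
    rw [hij] at hi
    have he : cycOff n k i.val = cycOff n k j.val := by omega
    have := i.isLt
    have := j.isLt
    apply Fin.ext
    unfold cycOff at he
    split_ifs at he <;> omega
  · intro i
    have dx : ∀ j : Fin (n - k), (SimpleGraph.cycleGraph n).dist x
        (cycShift x (cycOff n k j.val)) = min (cycOff n k j.val) (n - cycOff n k j.val) :=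
      fun j => cyc_dist' hn _ _ _ (hoff j) (cycShift_val x _ (hoff j))
    have dy : ∀ j : Fin (n - k), k ≤ cycOff n k j.val → (SimpleGraph.cycleGraph n).dist y
        (cycShift x (cycOff n k j.val)) =
          min (cycOff n k j.val - k) (n - (cycOff n k j.val - k)) := by
      intro j hj
      have h1 := cycShift_val x _ (hoff j)
      have h2 := hoff j
      have := (cycShift x (cycOff n k j.val)).isLt
      have := x.isLt
      have := y.isLt
      exact cyc_dist' hn _ _ _ (by omega) (by omega)
    have hi := i.isLt
    by_cases hc : i.val = 0 ∨ i.val % 2 = 1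
    · refine ⟨x, hx, fun j hij => ?_⟩
      have hij' : i.val < j.val := hij
      have hj := j.isLt
      simp only
      rw [dx, dx]
      unfold cycOff
      split_ifs <;> omega
    · refine ⟨y, hy, fun j hij => ?_⟩
      have hij' : i.val < j.val := hij
      have hj := j.isLt
      simp only
      rw [dy i (by unfold cycOff; split_ifs <;> omega),
        dy j (by unfold cycOff; split_ifs <;> omega)]
      unfold cycOff
      split_ifs <;> omega


/-- For the cycle graph on `n ≥ 3` vertices with leader set `V_ℓ` of size `m`
(`2 ≤ m ≤ n`), if `a` is the smallest graph distance between any two distinct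
leaders, then there is a PMI sequence of distance-to-leader vectors of length
at least `n - a`. -/
theorem stmt15 (n : ℕ) (hn : 3 ≤ n) (Vl : Finset (Fin n)) (m : ℕ)
    (hm : Vl.card = m) (hm1 : 2 ≤ m) (hmn : m ≤ n) (a : ℕ)
    (ha : IsLeast {k : ℕ | ∃ x ∈ Vl, ∃ y ∈ Vl, x ≠ y ∧
        (SimpleGraph.cycleGraph n).dist x y = k} a) :
    ∃ δ : ℕ, n - a ≤ δ ∧ ∃ f : Fin δ → Fin n,
      IsPMISeq (SimpleGraph.cycleGraph n) Vl f := by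
  obtain ⟨⟨x, hx, y, hy, hxy, hd⟩, -⟩ := ha
  wlog hlt : x.val < y.val generalizing x y with H
  · refine H y hy x hx hxy.symm (by rw [SimpleGraph.dist_comm]; exact hd) ?_
    have : x.val ≠ y.val := fun h => hxy (Fin.ext h)
    omega
  have hyn := y.isLt
  rw [cyc_dist hn x y hlt.le] at hd
  refine ⟨n - a, le_rfl, ?_⟩
  by_cases hc : a = y.val - x.val
  · exact cyc_core hn Vl x y hx hy a (by omega) (by omega) (by omega)
  · exact cyc_core hn Vl y x hy hx a (by omega) (by omega) (by omega)
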